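/- Each of the five vectors v_A, v_F, v_D, v_C4, v_K31 spans an extremal ray of the convex cone C ⊆ ℝ⁴ consisting of all nonnegative linear combinations of these five vectors: for every i ∈ {A, F, D, C4, K31}, if v_i = x + y with x, y ∈ C, then x and y are nonnegative scalar multiples of v_i. (This expresses, at the level of the computed classes, the conclusion of the Main Theorem that the five surfaces give five distinct extremal effective rays of the conjectured cone of effective surfaces on Ā₃.) -/

import Mathlib

noncomputable section

/-- The intersection-number vectors of the five effective surfaces
`S_A, S_F, S_D, σ̄_C4, σ̄_K3+1` against the basis `(L², LM, M², β₂)` of `H⁴(Ā₃;ℝ)`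
(Proposition 4.1 of the paper). Index `0 = A`, `1 = F`, `2 = D`, `3 = C4`, `4 = K3+1`. -/
def surfaceClass : Fin 5 → (Fin 4 → ℝ) :=
  ![![1/1152, 0, 0, 1/16],
    ![0, 1/96, 0, -1/8],
    ![0, 1/48, 1/24, -1/8],
    ![0, 0, 1/48, -1/16],
    ![0, 0, 1/4, 1/4]]

/-- Membership in the cone of nonnegative linear combinations of the five vectors. -/
def InCone (x : Fin 4 → ℝ) : Prop :=
  ∃ a : Fin 5 → ℝ, (∀ j, 0 ≤ a j) ∧ x = ∑ j, a j • surfaceClass j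

/-- The only linear relation among the classes is `v_D + v_C4 = 2 v_F + (1/4) v_K31`, so a class is
a nonnegative combination of the five only in the trivial way. -/
lemma coeff_eq_zero_of_sum_eq_surfaceClass {c : Fin 5 → ℝ} (hc : ∀ j, 0 ≤ c j) {i : Fin 5}
    (h : surfaceClass i = ∑ j, c j • surfaceClass j) {j : Fin 5} (hj : j ≠ i) : c j = 0 := by
  have h0 := congrFun h 0
  have h1 := congrFun h 1
  have h2 := congrFun h 2
  have h3 := congrFun h 3
  have c0 := hc 0
  have c1 := hc 1
  have c2 := hc 2
  have c3 := hc 3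
  have c4 := hc 4
  fin_cases i <;> simp [surfaceClass, Fin.sum_univ_five] at h0 h1 h2 h3 <;>
    fin_cases j <;> first | exact absurd rfl hj | (dsimp; linarith)

/-- A combination whose coefficients vanish away from `i` is a multiple of `v i`. -/
lemma sum_smul_surfaceClass_eq_single {a : Fin 5 → ℝ} {i : Fin 5} (h : ∀ j, j ≠ i → a j = 0) :
    ∑ j, a j • surfaceClass j = a i • surfaceClass i :=
  Fintype.sum_eq_single i fun j hj => by rw [h j hj, zero_smul]

/-- Each of the five vectors spans an extremal ray of the cone generated by all five:
whenever `v i = x + y` with `x, y` in the cone, both `x` and `y` are nonnegative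
multiples of `v i`. -/
theorem surfaceClasses_extremal :
    ∀ i : Fin 5, ∀ x y : Fin 4 → ℝ, InCone x → InCone y →
      surfaceClass i = x + y →
      ∃ s t : ℝ, 0 ≤ s ∧ 0 ≤ t ∧ x = s • surfaceClass i ∧ y = t • surfaceClass i := by
  rintro i _ _ ⟨a, ha, rfl⟩ ⟨b, hb, rfl⟩ h
  have hab : ∀ j, j ≠ i → a j + b j = 0 := fun j hj =>
    coeff_eq_zero_of_sum_eq_surfaceClass (c := fun j => a j + b j)
      (fun j => add_nonneg (ha j) (hb j))
      (by simpa only [add_smul, Finset.sum_add_distrib] using h) hj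
  exact ⟨a i, b i, ha i, hb i,
    sum_smul_surfaceClass_eq_single fun j hj => by linarith [hab j hj, ha j, hb j],
    sum_smul_surfaceClass_eq_single fun j hj => by linarith [hab j hj, ha j, hb j]⟩
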